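/- arXiv:1711.09310 — 4 statements merged into one kernel-verified Lean document; each statement's English description precedes it below -/
import Mathlib

section
/- Let P ⊂ ℝ^d be a centrally symmetric d-polytope that is 2-neighborly, i.e., for every two vertices u and w of P with w ≠ −u, the closed segment [u, w] is a face of P. Then P has at most 2^d vertices. -/
open Set

/-- A polytope: the convex hull of a finite set of points. -/
def IsPolytope {E : Type*} [AddCommGroup E] [Module ℝ E] (P : Set E) : Prop :=
  ∃ V : Finset E, P = convexHull ℝ (V : Set E)

/-- A (nonempty, proper) exposed face of `P`. -/
def IsProperFace {E : Type*} [AddCommGroup E] [Module ℝ E] [TopologicalSpace E]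
    (P F : Set E) : Prop :=
  F.Nonempty ∧ F ≠ P ∧ IsExposed ℝ P F

section Translates

open MeasureTheory
open scoped Pointwise

/-- A nonzero functional bounded above by `c` on `P` is strictly smaller than `c` on the interior
of `P`. -/
theorem StrongDual.lt_of_mem_interior {E : Type*} [AddCommGroup E] [Module ℝ E]
    [TopologicalSpace E] [ContinuousAdd E] [ContinuousSMul ℝ E] {P : Set E} {l : StrongDual ℝ E}
    (hl : l ≠ 0) {c : ℝ} (hc : ∀ y ∈ P, l y ≤ c) {x : E} (hx : x ∈ interior P) : l x < c := by
  have hsub : l '' interior P ⊆ interior (Iic c) :=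
    interior_maximal (image_subset_iff.2 fun y hy => hc y (interior_subset hy))
      (l.isOpenMap_of_ne_zero hl _ isOpen_interior)
  rw [interior_Iic] at hsub
  exact hsub (mem_image_of_mem l hx)

/-- A segment that is a proper face is cut out by a functional which takes the same value at both
endpoints and strictly smaller values on the interior. -/
theorem IsProperFace.exists_strongDual_of_segment {E : Type*} [AddCommGroup E] [Module ℝ E]
    [TopologicalSpace E] [ContinuousAdd E] [ContinuousSMul ℝ E] {P : Set E} {u v : E}
    (h : IsProperFace P (segment ℝ u v)) :
    ∃ l : StrongDual ℝ E, l u = l v ∧ ∀ x ∈ interior P, l x < l u := by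
  obtain ⟨hne, hproper, hexp⟩ := h
  obtain ⟨l, hl⟩ := hexp hne
  have hu : u ∈ {x ∈ P | ∀ y ∈ P, l y ≤ l x} := hl ▸ left_mem_segment ℝ u v
  have hv : v ∈ {x ∈ P | ∀ y ∈ P, l y ≤ l x} := hl ▸ right_mem_segment ℝ u v
  have hl0 : l ≠ 0 := by
    rintro rfl
    exact hproper (by simp [hl])
  exact ⟨l, le_antisymm (hv.2 u hu.1) (hu.2 v hv.1),
    fun x hx => StrongDual.lt_of_mem_interior hl0 hu.2 hx⟩

/-- If a functional separates `u` strictly from the interior of a centrally symmetric set and takes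
opposite values at `u` and `w`, then the translates of the interior by `u` and `w` are disjoint. -/
theorem disjoint_vadd_interior_of_strongDual {E : Type*} [AddCommGroup E] [Module ℝ E]
    [TopologicalSpace E] [IsTopologicalAddGroup E] {P : Set E} (hsym : P = -P) {u w : E}
    {l : StrongDual ℝ E} (hl : ∀ x ∈ interior P, l x < l u) (huw : l w = -l u) :
    Disjoint (u +ᵥ interior P) (w +ᵥ interior P) := by
  have hneg : ∀ x ∈ interior P, -x ∈ interior P := by
    intro x hx
    have h : interior (-P) = -interior P := ((Homeomorph.neg E).preimage_interior P).symm
    rw [hsym, h]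
    simpa using hx
  rw [Set.disjoint_left]
  rintro _ ⟨x, hx, rfl⟩ ⟨y, hy, hxy⟩
  have h1 := hl _ (hneg x hx)
  have h2 := hl y hy
  have h3 : l (w + y) = l (u + x) := congrArg l hxy
  simp only [map_add, map_neg] at h1 h3
  linarith

/-- The translates of a convex set's interior by points of the set lie in its dilate by `2`. -/
theorem Convex.vadd_interior_subset_two_smul {E : Type*} [AddCommGroup E] [Module ℝ E]
    [TopologicalSpace E] [IsTopologicalAddGroup E] [ContinuousSMul ℝ E] {P : Set E}
    (hP : Convex ℝ P) {u : E} (hu : u ∈ P) :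
    u +ᵥ interior P ⊆ (2 : ℝ) • interior P := by
  rintro _ ⟨x, hx, rfl⟩
  refine ⟨(1 / 2 : ℝ) • u + (1 / 2 : ℝ) • x,
    hP.combo_self_interior_mem_interior hu hx (by norm_num) (by norm_num) (by norm_num), ?_⟩
  simp [smul_smul]

/-- A finite set of points of a bounded convex body whose interior has pairwise disjoint translates
by these points has at most `2 ^ d` elements. -/
theorem Convex.card_le_two_pow_of_pairwiseDisjoint_vadd {d : ℕ} {P : Set (Fin d → ℝ)}
    (hP : Convex ℝ P) (hbdd : Bornology.IsBounded P) (hint : (interior P).Nonempty)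
    {S : Finset (Fin d → ℝ)} (hS : (S : Set (Fin d → ℝ)) ⊆ P)
    (hdisj : (S : Set (Fin d → ℝ)).PairwiseDisjoint fun u => u +ᵥ interior P) :
    S.card ≤ 2 ^ d := by
  have hpos : volume (interior P) ≠ 0 := (isOpen_interior.measure_pos volume hint).ne'
  have hfin : volume (interior P) ≠ ⊤ := (hbdd.subset interior_subset).measure_lt_top.ne
  have hle : (S.card : ENNReal) * volume (interior P) ≤ 2 ^ d * volume (interior P) := by
    calc (S.card : ENNReal) * volume (interior P)
        = ∑ u ∈ S, volume (u +ᵥ interior P) := by simp [measure_vadd]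
      _ = volume (⋃ u ∈ S, (u +ᵥ interior P)) :=
          (measure_biUnion_finset hdisj
            fun u _ => (isOpen_interior.vadd u).measurableSet).symm
      _ ≤ volume ((2 : ℝ) • interior P) :=
          measure_mono (iUnion₂_subset fun u hu => hP.vadd_interior_subset_two_smul (hS hu))
      _ = 2 ^ d * volume (interior P) := by
          rw [Measure.addHaar_smul]
          simp [ENNReal.ofReal_pow]
  exact_mod_cast (ENNReal.mul_le_mul_iff_left hpos hfin).1 hle

end Translates

theorem stmt1 {d : ℕ} (P : Set (Fin d → ℝ))
    (hpoly : IsPolytope P) (hsym : P = -P) (hfull : affineSpan ℝ P = ⊤)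
    (hneighb : ∀ u ∈ P.extremePoints ℝ, ∀ w ∈ P.extremePoints ℝ,
      u ≠ w → w ≠ -u → IsProperFace P (segment ℝ u w)) :
    (P.extremePoints ℝ).ncard ≤ 2 ^ d := by
  obtain ⟨V, hV⟩ := hpoly
  have hconv : Convex ℝ P := hV ▸ convex_convexHull ℝ _
  have hbdd : Bornology.IsBounded P := hV ▸ isBounded_convexHull.2 V.finite_toSet.isBounded
  have hfin : (P.extremePoints ℝ).Finite :=
    V.finite_toSet.subset (hV ▸ extremePoints_convexHull_subset)
  have hneg : ∀ w ∈ P.extremePoints ℝ, -w ∈ P.extremePoints ℝ := by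
    intro w hw
    have h := image_extremePoints (LinearEquiv.neg ℝ : (Fin d → ℝ) ≃ₗ[ℝ] (Fin d → ℝ)) P
    have himg : (LinearEquiv.neg ℝ : (Fin d → ℝ) ≃ₗ[ℝ] (Fin d → ℝ)) '' P = P := by
      conv_rhs => rw [hsym]
      exact Set.image_neg_eq_neg
    rw [himg] at h
    exact h ▸ ⟨w, hw, rfl⟩
  rw [ncard_eq_toFinset_card _ hfin]
  refine hconv.card_le_two_pow_of_pairwiseDisjoint_vadd hbdd
    (hconv.interior_nonempty_iff_affineSpan_eq_top.2 hfull)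
    (by simpa using extremePoints_subset) ?_
  rw [hfin.coe_toFinset]
  intro u hu w hw huw
  by_cases hwu : w = -u
  · have : Nontrivial (Fin d → ℝ) := ⟨u, w, huw⟩
    obtain ⟨l, hl⟩ := geometric_hahn_banach_open_point hconv.interior isOpen_interior
      ((disjoint_interior_extremePoints P).notMem_of_mem_right hu)
    exact disjoint_vadd_interior_of_strongDual hsym hl (by simp [hwu])
  · obtain ⟨l, hlu, hl⟩ := (hneighb u hu (-w) (hneg w hw) (fun h => hwu (by simp [h]))
      (fun h => huw (neg_injective h).symm)).exists_strongDual_of_segment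
    exact disjoint_vadd_interior_of_strongDual hsym hl (by simp [hlu])
end

section
/- Let d ≥ 4 and let P ⊂ ℝ^d be a centrally symmetric d-polytope with N vertices. Then the number of edges of P satisfies f_1(P) ≤ (1 − 2^{−d}) · N²/2. -/
open Set

/-- The number of `j`-dimensional proper faces of `P`. -/
noncomputable def faceCount {d : ℕ} (P : Set (Fin d → ℝ)) (j : ℕ) : ℕ :=
  Set.ncard {F : Set (Fin d → ℝ) |
    IsProperFace P F ∧ Module.finrank ℝ (affineSpan ℝ F).direction = j}

open MeasureTheory

/-- A compact convex set spanning a line is a segment whose endpoints are its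
extreme points. -/
theorem exists_extremePoints_eq_segment {E : Type*} [AddCommGroup E] [Module ℝ E]
    [TopologicalSpace E] [T2Space E] [IsTopologicalAddGroup E] [ContinuousSMul ℝ E]
    [LocallyConvexSpace ℝ E] [FiniteDimensional ℝ E] {F : Set E}
    (hF : IsCompact F) (hconv : Convex ℝ F)
    (hdim : Module.finrank ℝ (affineSpan ℝ F).direction = 1) :
    ∃ u ∈ F.extremePoints ℝ, ∃ w ∈ F.extremePoints ℝ, u ≠ w ∧ F = segment ℝ u w := by
  have hcl := closure_convexHull_extremePoints hF hconv
  rw [direction_affineSpan] at hdim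
  have hcol : Collinear ℝ F := collinear_iff_finrank_le_one.2 hdim.le
  have hnt : (F.extremePoints ℝ).Nontrivial := by
    rw [← Set.not_subsingleton_iff]
    intro hs
    rcases hs.eq_empty_or_singleton with h | ⟨x, h⟩
    · rw [h, convexHull_empty, closure_empty] at hcl
      rw [← hcl, vectorSpan_empty, finrank_bot] at hdim
      exact zero_ne_one hdim
    · rw [h, convexHull_singleton, closure_singleton] at hcl
      rw [← hcl, vectorSpan_singleton, finrank_bot] at hdim
      exact zero_ne_one hdim
  obtain ⟨u, hu, w, hw, huw⟩ := hnt
  refine ⟨u, hu, w, hw, huw, ?_⟩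
  have hbtw : ∀ {a b c : E}, a ∈ F → b ∈ F.extremePoints ℝ → c ∈ F → Wbtw ℝ a b c →
      b = a ∨ b = c := by
    intro a b c ha hb hc h
    rcases (mem_extremePoints_iff_forall_segment.1 hb).2 a ha c hc
      (mem_segment_iff_wbtw.2 h) with h | h
    exacts [Or.inl h.symm, Or.inr h.symm]
  have hext : F.extremePoints ℝ = {u, w} := by
    refine Set.Subset.antisymm (fun x hx => ?_) (by rintro x (rfl | rfl) <;> assumption)
    have h3 : Collinear ℝ ({x, u, w} : Set E) := hcol.subset (by
      rintro y (rfl | rfl | rfl)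
      exacts [hx.1, hu.1, hw.1])
    rcases h3.wbtw_or_wbtw_or_wbtw with h | h | h
    · exact Or.inl ((hbtw hx.1 hu hw.1 h).resolve_right huw).symm
    · exact Or.inr ((hbtw hu.1 hw hx.1 h).resolve_left huw.symm).symm
    · exact (hbtw hw.1 hx hu.1 h).symm
  rw [hext, ((Set.toFinite _).isClosed_convexHull ℝ).closure_eq, convexHull_pair] at hcl
  exact hcl.symm

/-- A proper exposed face does not meet the interior. -/
theorem IsExposed.notMem_interior {E : Type*} [NormedAddCommGroup E] [NormedSpace ℝ E]
    {P F : Set E} (hF : IsExposed ℝ P F) (hne : F ≠ P) {x : E} (hx : x ∈ F) :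
    x ∉ interior P := by
  intro hxi
  obtain ⟨l, rfl⟩ := hF ⟨x, hx⟩
  have hmax : IsLocalMax l x :=
    Filter.eventually_of_mem (mem_interior_iff_mem_nhds.1 hxi) hx.2
  have hl : l = 0 := hmax.hasFDerivAt_eq_zero l.hasFDerivAt
  exact hne (by simp [hl])

/-- A Cauchy–Schwarz inequality for the overlaps of finitely many subsets of a set. -/
theorem sq_sum_measureReal_le {α ι : Type*} [MeasurableSpace α] (μ : Measure α)
    (s : Finset ι) (A : ι → Set α) {B : Set α} (hA : ∀ i ∈ s, MeasurableSet (A i))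
    (hB : MeasurableSet B) (hμB : μ B ≠ ⊤) (hAB : ∀ i ∈ s, A i ⊆ B) :
    (∑ i ∈ s, μ.real (A i)) ^ 2 ≤
      μ.real B * ∑ i ∈ s, ∑ j ∈ s, μ.real (A i ∩ A j) := by
  set a := ∑ i ∈ s, μ.real (A i) with ha
  set b := μ.real B with hb
  have hμA : ∀ i ∈ s, μ (A i) ≠ ⊤ := fun i hi => measure_ne_top_of_subset (hAB i hi) hμB
  have hint : ∀ i ∈ s, Integrable ((A i).indicator (1 : α → ℝ)) μ := fun i hi =>
    (integrable_indicator_iff (hA i hi)).2 (integrableOn_const (hμA i hi))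
  have hintB : Integrable (B.indicator (1 : α → ℝ)) μ :=
    (integrable_indicator_iff hB).2 (integrableOn_const hμB)
  have hint2 : ∀ i ∈ s, ∀ j ∈ s, Integrable ((A i ∩ A j).indicator (1 : α → ℝ)) μ :=
    fun i hi j hj => (integrable_indicator_iff ((hA i hi).inter (hA j hj))).2
      (integrableOn_const (measure_ne_top_of_subset inter_subset_left (hμA i hi)))
  have hexp : ∀ x, (b * ∑ i ∈ s, (A i).indicator (1 : α → ℝ) x - a * B.indicator 1 x) ^ 2 =
      b ^ 2 * ∑ i ∈ s, ∑ j ∈ s, (A i ∩ A j).indicator (1 : α → ℝ) x -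
        2 * a * b * ∑ i ∈ s, (A i).indicator (1 : α → ℝ) x +
        a ^ 2 * B.indicator (1 : α → ℝ) x := by
    intro x
    have h1 : (∑ i ∈ s, (A i).indicator (1 : α → ℝ) x) * B.indicator 1 x =
        ∑ i ∈ s, (A i).indicator (1 : α → ℝ) x := by
      rw [Finset.sum_mul]
      refine Finset.sum_congr rfl fun i hi => ?_
      by_cases hx : x ∈ A i
      · simp [hx, hAB i hi hx]
      · simp [hx]
    have h2 : B.indicator (1 : α → ℝ) x * B.indicator (1 : α → ℝ) x = B.indicator 1 x := by
      by_cases hx : x ∈ B <;> simp [hx]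
    have h3 : ∑ i ∈ s, ∑ j ∈ s, (A i ∩ A j).indicator (1 : α → ℝ) x =
        (∑ i ∈ s, (A i).indicator (1 : α → ℝ) x) *
          ∑ i ∈ s, (A i).indicator (1 : α → ℝ) x := by
      simp only [Finset.sum_mul_sum, Set.inter_indicator_one, Pi.mul_apply]
    rw [h3]
    linear_combination (-2 * a * b) * h1 + a ^ 2 * h2
  have hnn : 0 ≤ ∫ x, (b * ∑ i ∈ s, (A i).indicator (1 : α → ℝ) x -
      a * B.indicator 1 x) ^ 2 ∂μ := integral_nonneg fun x => sq_nonneg _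
  have hI1 : Integrable (fun x => ∑ i ∈ s, (A i).indicator (1 : α → ℝ) x) μ :=
    integrable_finsetSum s hint
  have hI2 : Integrable (fun x => ∑ i ∈ s, ∑ j ∈ s, (A i ∩ A j).indicator (1 : α → ℝ) x) μ :=
    integrable_finsetSum s fun i hi => integrable_finsetSum s (hint2 i hi)
  simp_rw [hexp] at hnn
  have hI3 : Integrable (fun x => b ^ 2 * ∑ i ∈ s, ∑ j ∈ s,
      (A i ∩ A j).indicator (1 : α → ℝ) x -
        2 * a * b * ∑ i ∈ s, (A i).indicator (1 : α → ℝ) x) μ :=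
    (hI2.const_mul _).sub (hI1.const_mul _)
  rw [integral_add hI3 (hintB.const_mul _),
    integral_sub (hI2.const_mul _) (hI1.const_mul _), integral_const_mul, integral_const_mul,
    integral_const_mul, integral_finsetSum s hint,
    integral_finsetSum s fun i hi => integrable_finsetSum s (hint2 i hi),
    integral_indicator_one hB, Finset.sum_congr rfl fun i hi => integral_indicator_one (hA i hi),
    Finset.sum_congr rfl fun i hi => (integral_finsetSum s (hint2 i hi)).trans
      (Finset.sum_congr rfl fun j hj =>
        integral_indicator_one ((hA i hi).inter (hA j hj)))] at hnn
  rw [← ha, ← hb] at hnn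
  rcases (measureReal_nonneg : 0 ≤ b).eq_or_lt with h0 | h0
  · have h : a = 0 := Finset.sum_eq_zero fun i hi =>
      le_antisymm ((measureReal_mono (hAB i hi) hμB).trans h0.ge) measureReal_nonneg
    have h' : b = 0 := h0.symm
    simp [h, h']
  · refine le_of_mul_le_mul_left ?_ h0
    linarith

open Classical Pointwise in
/-- For a symmetric bounded convex body `P` and `N` points in it, at least `N ^ 2 / 2 ^ d` of the
ordered pairs of points have half their difference in the interior of `P`. -/
theorem card_sq_le_two_pow_mul_card_interior {E : Type*} [NormedAddCommGroup E]
    [NormedSpace ℝ E] [FiniteDimensional ℝ E] {P : Set E} (hconv : Convex ℝ P)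
    (hbdd : Bornology.IsBounded P) (hsym : P = -P) (hne : (interior P).Nonempty) (V : Finset E)
    (hV : ∀ v ∈ V, v ∈ P) :
    (V.card : ℝ) ^ 2 ≤ 2 ^ Module.finrank ℝ E *
      (((V ×ˢ V).filter fun p => (2⁻¹ : ℝ) • (p.1 - p.2) ∈ interior P).card : ℝ) := by
  borelize E
  let μ : Measure E := Measure.addHaar
  set K := interior P with hK
  have hKm : MeasurableSet K := isOpen_interior.measurableSet
  have hKfin : μ K ≠ ⊤ := (hbdd.subset interior_subset).measure_lt_top.ne
  have hKpos : 0 < μ.real K :=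
    ENNReal.toReal_pos (isOpen_interior.measure_pos μ hne).ne' hKfin
  have hneg : ∀ x ∈ K, -x ∈ K := by
    intro x hx
    have h : Neg.neg ⁻¹' K = interior (Neg.neg ⁻¹' P) := (Homeomorph.neg E).preimage_interior P
    rw [show Neg.neg ⁻¹' P = P from hsym.symm] at h
    exact h.ge hx
  have hsub : ∀ v ∈ V, v +ᵥ K ⊆ (2 : ℝ) • K := by
    rintro v hv _ ⟨k, hk, rfl⟩
    refine ⟨(2⁻¹ : ℝ) • k + (2⁻¹ : ℝ) • v, hconv.combo_interior_self_mem_interior hk (hV v hv)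
      (by norm_num) (by norm_num) (by norm_num), ?_⟩
    simp only [vadd_eq_add]
    module
  have h2K : μ.real ((2 : ℝ) • K) = 2 ^ Module.finrank ℝ E * μ.real K := by
    simp [measureReal_def, Measure.addHaar_smul]
  have hcs := sq_sum_measureReal_le μ V (fun v => v +ᵥ K) (fun v _ => hKm.const_vadd v)
    (hKm.const_smul₀ (2 : ℝ)) (by
      rw [Measure.addHaar_smul]
      exact ENNReal.mul_ne_top ENNReal.ofReal_ne_top hKfin) hsub
  have hvol : ∀ v : E, μ.real (v +ᵥ K) = μ.real K := fun v => by
    simp [measureReal_def]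
  have hpair : ∑ u ∈ V, ∑ v ∈ V, μ.real ((u +ᵥ K) ∩ (v +ᵥ K)) ≤
      (((V ×ˢ V).filter fun p => (2⁻¹ : ℝ) • (p.1 - p.2) ∈ K).card : ℝ) * μ.real K := by
    rw [← Finset.sum_product', ← nsmul_eq_mul, ← Finset.sum_const, Finset.sum_filter]
    refine Finset.sum_le_sum fun p _ => ?_
    split_ifs with hp
    · rw [← hvol p.1]
      exact measureReal_mono inter_subset_left (by simpa using hKfin)
    · rw [Set.eq_empty_of_forall_notMem (s := (p.1 +ᵥ K) ∩ (p.2 +ᵥ K)), measureReal_empty]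
      rintro _ ⟨⟨k, hk, rfl⟩, k', hk', h⟩
      refine hp ?_
      have h' : p.2 + k' = p.1 + k := h
      have := hconv.interior hk' (hneg k hk) (by norm_num : (0 : ℝ) ≤ 2⁻¹)
        (by norm_num : (0 : ℝ) ≤ 2⁻¹) (by norm_num)
      convert this using 1
      rw [← smul_add, sub_eq_iff_eq_add.2 (show p.1 = k' + -k + p.2 by
        rw [eq_sub_of_add_eq h'.symm]; abel)]
  simp only [hvol, Finset.sum_const, nsmul_eq_mul, h2K] at hcs
  have hpow : (0 : ℝ) ≤ 2 ^ Module.finrank ℝ E * μ.real K := by positivity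
  have := hcs.trans (mul_le_mul_of_nonneg_left hpair hpow)
  refine le_of_mul_le_mul_right ?_ (pow_pos hKpos 2)
  linarith

theorem stmt2 {d N : ℕ} (hd : 4 ≤ d) (P : Set (Fin d → ℝ))
    (hpoly : IsPolytope P) (hsym : P = -P) (hfull : affineSpan ℝ P = ⊤)
    (hN : (P.extremePoints ℝ).ncard = N) :
    (faceCount P 1 : ℝ) ≤ (1 - 2 ^ (-(d : ℤ))) * N ^ 2 / 2 := by
  classical
  obtain ⟨V₀, hV₀⟩ := hpoly
  have hconv : Convex ℝ P := hV₀ ▸ convex_convexHull ℝ _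
  have hcomp : IsCompact P := hV₀ ▸ V₀.finite_toSet.isCompact_convexHull ℝ
  have hfin : (P.extremePoints ℝ).Finite :=
    V₀.finite_toSet.subset (by rw [hV₀]; exact extremePoints_convexHull_subset)
  obtain ⟨V, hV⟩ := hfin.exists_finset_coe
  have hVmem : ∀ {v}, v ∈ V ↔ v ∈ P.extremePoints ℝ := fun {v} => by rw [← hV, Finset.mem_coe]
  have hVcard : V.card = N := by rw [← hN, ← hV, Set.ncard_coe_finset]
  have hVneg : ∀ v ∈ V, -v ∈ V := by
    intro v hv
    rw [hVmem] at hv ⊢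
    have h := image_extremePoints (𝕜 := ℝ) (LinearEquiv.neg ℝ (M := Fin d → ℝ)) P
    have himg : (LinearEquiv.neg ℝ (M := Fin d → ℝ)) '' P = P := by
      conv_rhs => rw [hsym]
      simp [← Set.image_neg_eq_neg]
    rw [himg] at h
    rw [← h]
    exact ⟨v, hv, rfl⟩
  set T := (V ×ˢ V).filter fun p => (2⁻¹ : ℝ) • (p.1 - p.2) ∈ interior P with hT
  have hlow : (N : ℝ) ^ 2 ≤ 2 ^ d * (T.card : ℝ) := by
    have := card_sq_le_two_pow_mul_card_interior hconv hcomp.isBounded hsym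
      (hconv.interior_nonempty_iff_affineSpan_eq_top.2 hfull) V fun v hv => (hVmem.1 hv).1
    rwa [hVcard, Module.finrank_fin_fun] at this
  have hedge : ∀ F ∈ {F : Set (Fin d → ℝ) |
      IsProperFace P F ∧ Module.finrank ℝ (affineSpan ℝ F).direction = 1},
      ∃ p : (Fin d → ℝ) × (Fin d → ℝ), p.1 ∈ V ∧ p.2 ∈ V ∧ p.1 ≠ p.2 ∧ F = segment ℝ p.1 p.2 ∧
        (2⁻¹ : ℝ) • (p.1 + p.2) ∉ interior P := by
    rintro F ⟨⟨-, hFP, hexp⟩, hdim⟩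
    obtain ⟨u, hu, w, hw, huw, rfl⟩ := exists_extremePoints_eq_segment
      (hexp.isCompact hcomp) (hexp.convex hconv) hdim
    have hsub := hexp.isExtreme.extremePoints_subset_extremePoints
    refine ⟨(u, w), hVmem.2 (hsub hu), hVmem.2 (hsub hw), huw, rfl,
      hexp.notMem_interior hFP ⟨2⁻¹, 2⁻¹, by norm_num, by norm_num, by norm_num, ?_⟩⟩
    rw [smul_add]
  choose! p hp1 hp2 hpne hpF hpint using hedge
  set S := {F : Set (Fin d → ℝ) |
      IsProperFace P F ∧ Module.finrank ℝ (affineSpan ℝ F).direction = 1} with hS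
  let g : Set (Fin d → ℝ) × Bool → (Fin d → ℝ) × (Fin d → ℝ) := fun q =>
    if q.2 then ((p q.1).1, -(p q.1).2) else ((p q.1).2, -(p q.1).1)
  have hmaps : ∀ q ∈ S ×ˢ (Set.univ : Set Bool), g q ∈ ((V ×ˢ V \ T : Finset _) : Set _) := by
    rintro ⟨F, b⟩ ⟨hF, -⟩
    have h := hpint F hF
    cases b
    · simp [g, hT, hp2 F hF, hVneg _ (hp1 F hF), -smul_add, add_comm (p F).2, h]
    · simp [g, hT, hp1 F hF, hVneg _ (hp2 F hF), -smul_add, h]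
  have hinj : Set.InjOn g (S ×ˢ Set.univ) := by
    rintro ⟨F, b⟩ ⟨hF, -⟩ ⟨F', b'⟩ ⟨hF', -⟩ h
    have h1 := hpF F hF
    have h2 := hpF F' hF'
    have h3 := hpne F hF
    have hFF : F = F' := by
      cases b <;> cases b' <;> simp [g] at h <;> rw [h1, h2, h.1, h.2]
      · exact segment_symm ℝ _ _
      · exact segment_symm ℝ _ _
    subst hFF
    cases b <;> cases b' <;> simp [g] at h ⊢
    · exact h3 h.2
    · exact h3 h.1
  have hTsub : T ⊆ V ×ˢ V := Finset.filter_subset _ _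
  have hTle : T.card ≤ N * N := by
    rw [← hVcard, ← Finset.card_product]
    exact Finset.card_le_card hTsub
  have hcard := Set.ncard_le_ncard_of_injOn g hmaps hinj
  rw [Set.ncard_prod, Set.ncard_univ, Nat.card_eq_fintype_card, Fintype.card_bool,
    Set.ncard_coe_finset, Finset.card_sdiff_of_subset hTsub,
    Finset.card_product, hVcard] at hcard
  have hup : (S.ncard : ℝ) * 2 + T.card ≤ N ^ 2 := by
    rw [sq]
    exact_mod_cast (show S.ncard * 2 + T.card ≤ N * N by omega)
  have hdiv : (2 : ℝ) ^ (-(d : ℤ)) * N ^ 2 ≤ T.card := by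
    rw [zpow_neg, zpow_natCast]
    exact inv_mul_le_of_le_mul₀ (by positivity) (Nat.cast_nonneg _) hlow
  change (S.ncard : ℝ) ≤ _
  linarith
end

section
/- Let d ≥ 4. For every N₀ there exist N ≥ N₀ and a centrally symmetric d-polytope P ⊂ ℝ^d with N vertices and at least (1 − 3^{−⌊d/2 − 1⌋}) · C(N,2) edges, where C(N,2) = N(N−1)/2. -/
open Set

section Faces

variable {E : Type*} [NormedAddCommGroup E] [NormedSpace ℝ E] {V F : Set E}

/-- An exposed face of the convex hull of a finite set is spanned by the points it contains. -/
lemma IsExposed.eq_convexHull_inter (hV : V.Finite) (hF : IsExposed ℝ (convexHull ℝ V) F) :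
    F = convexHull ℝ (F ∩ V) := by
  have hcomp : IsCompact (convexHull ℝ V) := hV.isCompact_convexHull ℝ
  have hconv : Convex ℝ F := hF.convex (convex_convexHull ℝ V)
  refine Subset.antisymm ?_ (convexHull_min inter_subset_left hconv)
  have hsub : F.extremePoints ℝ ⊆ F ∩ V := by
    rw [hF.isExtreme.extremePoints_eq]
    exact inter_subset_inter_right _ extremePoints_convexHull_subset
  have hclosed : IsClosed (convexHull ℝ (F ∩ V)) :=
    ((hV.subset inter_subset_right).isCompact_convexHull ℝ).isClosed
  calc F = closure (convexHull ℝ (F.extremePoints ℝ)) :=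
        (closure_convexHull_extremePoints (hF.isCompact hcomp) hconv).symm
    _ ⊆ convexHull ℝ (F ∩ V) := closure_minimal (convexHull_mono hsub) hclosed

lemma finite_setOf_isExposed_convexHull (hV : V.Finite) :
    {F : Set E | IsExposed ℝ (convexHull ℝ V) F}.Finite := by
  refine (hV.finite_subsets.image (convexHull ℝ)).subset fun F hF => ?_
  exact ⟨F ∩ V, inter_subset_right, (IsExposed.eq_convexHull_inter hV hF).symm⟩

lemma le_of_mem_convexHull {l : StrongDual ℝ E} {c : ℝ} (h : ∀ v ∈ V, l v ≤ c) {x : E}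
    (hx : x ∈ convexHull ℝ V) : l x ≤ c :=
  convexHull_min (t := {x | l x ≤ c}) h (convex_halfSpace_le l.toLinearMap.isLinear c) hx

lemma eq_of_mem_convexHull {l : StrongDual ℝ E} {c : ℝ} (h : ∀ v ∈ V, l v = c) {x : E}
    (hx : x ∈ convexHull ℝ V) : l x = c :=
  convexHull_min (t := {x | l x = c}) h (convex_hyperplane l.toLinearMap.isLinear c) hx

/-- The maximizers in `V` of a linear functional span an exposed face of the hull of `V`. -/
lemma isExposed_convexHull_of_forall_le (hV : V.Finite) {S : Set E} (hSV : S ⊆ V)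
    {l : StrongDual ℝ E} {c : ℝ} (hS : ∀ v ∈ S, l v = c) (hlt : ∀ v ∈ V, v ∉ S → l v < c) :
    IsExposed ℝ (convexHull ℝ V) (convexHull ℝ S) := by
  intro hne
  obtain ⟨s, hs⟩ := convexHull_nonempty_iff.1 hne
  have hle : ∀ v ∈ V, l v ≤ c := fun v hv => by
    by_cases hvS : v ∈ S
    exacts [(hS v hvS).le, (hlt v hv hvS).le]
  refine ⟨l, ?_⟩
  have hF := ContinuousLinearMap.toExposed.isExposed (l := l) (A := convexHull ℝ V)
  have heq := hF.eq_convexHull_inter hV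
  change _ = l.toExposed (convexHull ℝ V)
  refine Subset.antisymm (fun x hx => ⟨convexHull_mono hSV hx, fun y hy => ?_⟩) ?_
  · exact (le_of_mem_convexHull hle hy).trans (eq_of_mem_convexHull hS hx).ge
  · rw [heq]
    refine convexHull_mono ?_
    rintro x ⟨hxF, hxV⟩
    by_contra hxS
    have h1 := hxF.2 s (subset_convexHull ℝ V (hSV hs))
    have h2 := hlt x hxV hxS
    rw [hS s hs] at h1
    exact h1.not_gt h2

lemma convexHull_inter_of_forall_lt {S : Set E} (hSV : S ⊆ V)
    {l : StrongDual ℝ E} {c : ℝ} (hS : ∀ v ∈ S, l v = c) (hlt : ∀ v ∈ V, v ∉ S → l v < c) :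
    convexHull ℝ S ∩ V = S := by
  refine Subset.antisymm ?_ fun x hx => ⟨subset_convexHull ℝ S hx, hSV hx⟩
  rintro x ⟨hx, hxV⟩
  by_contra hxS
  exact (hlt x hxV hxS).ne (eq_of_mem_convexHull hS hx)

lemma finrank_direction_affineSpan_convexHull_pair {u v : E} (h : u ≠ v) :
    Module.finrank ℝ (affineSpan ℝ (convexHull ℝ {u, v})).direction = 1 := by
  rw [affineSpan_convexHull, direction_affineSpan, vectorSpan_pair]
  exact finrank_span_singleton (by simpa [sub_eq_zero] using h)

/-- If sufficiently many pairs of points are exposed by linear functionals, the convex hull has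
many edges. -/
lemma card_le_two_mul_faceCount {d : ℕ} (hd : 2 ≤ d) {ι : Type*} [DecidableEq ι]
    {s : Finset ι} {v : ι → Fin d → ℝ} (hinj : InjOn v s)
    (htop : affineSpan ℝ (convexHull ℝ (v '' s)) = ⊤) {G : Finset (ι × ι)}
    (hG : ∀ p ∈ G, p.1 ∈ s ∧ p.2 ∈ s ∧ p.1 ≠ p.2 ∧ ∃ (l : StrongDual ℝ (Fin d → ℝ)) (c : ℝ),
      l (v p.1) = c ∧ l (v p.2) = c ∧ ∀ k ∈ s, k ≠ p.1 → k ≠ p.2 → l (v k) < c) :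
    G.card ≤ 2 * faceCount (convexHull ℝ (v '' s)) 1 := by
  classical
  set V := v '' (s : Set ι) with hVdef
  have hV : V.Finite := s.finite_toSet.image v
  have key : ∀ p ∈ G, ({v p.1, v p.2} : Set (Fin d → ℝ)) ⊆ V ∧
      ∃ (l : StrongDual ℝ (Fin d → ℝ)) (c : ℝ),
      (∀ x ∈ ({v p.1, v p.2} : Set (Fin d → ℝ)), l x = c) ∧
      ∀ x ∈ V, x ∉ ({v p.1, v p.2} : Set (Fin d → ℝ)) → l x < c := by
    intro p hp
    obtain ⟨h1, h2, -, l, c, hl1, hl2, hlt⟩ := hG p hp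
    refine ⟨by rintro x (rfl | rfl); exacts [⟨_, h1, rfl⟩, ⟨_, h2, rfl⟩], l, c, ?_, ?_⟩
    · rintro x (rfl | rfl) <;> assumption
    · rintro x ⟨k, hk, rfl⟩ hx
      refine hlt k hk ?_ ?_ <;> rintro rfl <;> simp at hx
  set f : ι × ι → Set (Fin d → ℝ) := fun p => convexHull ℝ {v p.1, v p.2} with hf
  have hfV : ∀ p ∈ G, f p ∩ V = {v p.1, v p.2} := fun p hp => by
    obtain ⟨hsub, l, c, h1, h2⟩ := key p hp
    exact convexHull_inter_of_forall_lt hsub h1 h2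
  refine (Finset.card_le_mul_card_image (f := f) G 2 ?_).trans
    (Nat.mul_le_mul_left 2 ?_)
  · intro b hb
    obtain ⟨q, hq, rfl⟩ := Finset.mem_image.1 hb
    refine (Finset.card_le_card (t := {q, (q.2, q.1)}) ?_).trans Finset.card_le_two
    intro p hp
    obtain ⟨hp, hpq⟩ := Finset.mem_filter.1 hp
    have h := hfV p hp
    rw [hpq, hfV q hq, pair_eq_pair_iff] at h
    obtain ⟨hq1, hq2, -⟩ := hG q hq
    obtain ⟨hp1, hp2, -⟩ := hG p hp
    rcases h with ⟨h1, h2⟩ | ⟨h1, h2⟩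
    · have h1 := hinj hq1 hp1 h1
      have h2 := hinj hq2 hp2 h2
      simp [Prod.ext_iff, h1, h2]
    · have h1 := hinj hq1 hp2 h1
      have h2 := hinj hq2 hp1 h2
      simp [Prod.ext_iff, h1, h2]
  · rw [← Set.ncard_coe_finset]
    refine Set.ncard_le_ncard ?_
      ((finite_setOf_isExposed_convexHull hV).subset fun F hF => hF.1.2.2)
    intro F hF
    obtain ⟨p, hp, rfl⟩ := Finset.mem_image.1 (Finset.mem_coe.1 hF)
    obtain ⟨hsub, l, c, h1, h2⟩ := key p hp
    obtain ⟨hp1, hp2, hne, -⟩ := hG p hp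
    have hrank := finrank_direction_affineSpan_convexHull_pair
      (fun h => hne (hinj hp1 hp2 h) : v p.1 ≠ v p.2)
    refine ⟨⟨⟨v p.1, subset_convexHull ℝ _ (by simp)⟩, fun h => ?_,
      isExposed_convexHull_of_forall_le hV hsub h1 h2⟩, hrank⟩
    simp only [hf] at h
    rw [h, htop, AffineSubspace.direction_top, finrank_top] at hrank
    simp at hrank
    omega

end Faces

/-- A point where a linear functional has its strict maximum over `V` is a vertex. -/
lemma mem_extremePoints_convexHull_of_forall_lt {E : Type*} [NormedAddCommGroup E]
    [NormedSpace ℝ E] {V : Set E} (hV : V.Finite) {u : E} (hu : u ∈ V) (l : StrongDual ℝ E)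
    (hlt : ∀ v ∈ V, v ≠ u → l v < l u) : u ∈ (convexHull ℝ V).extremePoints ℝ := by
  have h := isExposed_convexHull_of_forall_le hV (S := {u}) (l := l) (c := l u) (by simpa)
    (by simp) (by simpa using hlt)
  rw [convexHull_singleton] at h
  exact h.isExtreme.mem_extremePoints

/-- Two points of the circle at angular distance less than `2π/3` are exposed by a trigonometric
polynomial with frequencies `1` and `3`. -/
lemma exists_trig_maximizer {a b : ℝ} (h : -(1 / 2) < Real.cos (a - b)) :
    ∃ A τ c : ℝ, A * Real.cos (a - τ) - Real.cos (3 * (a - τ)) = c ∧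
      A * Real.cos (b - τ) - Real.cos (3 * (b - τ)) = c ∧
      ∀ x : ℝ, A * Real.cos (x - τ) - Real.cos (3 * (x - τ)) ≤ c ∧
        (A * Real.cos (x - τ) - Real.cos (3 * (x - τ)) = c →
          ∃ n : ℤ, x = a + n * (2 * Real.pi) ∨ x = b + n * (2 * Real.pi)) := by
  have main : ∀ a b : ℝ, 1 / 2 < Real.cos ((a - b) / 2) →
    ∃ A τ c : ℝ, A * Real.cos (a - τ) - Real.cos (3 * (a - τ)) = c ∧
      A * Real.cos (b - τ) - Real.cos (3 * (b - τ)) = c ∧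
      ∀ x : ℝ, A * Real.cos (x - τ) - Real.cos (3 * (x - τ)) ≤ c ∧
        (A * Real.cos (x - τ) - Real.cos (3 * (x - τ)) = c →
          ∃ n : ℤ, x = a + n * (2 * Real.pi) ∨ x = b + n * (2 * Real.pi)) := by
    intro a b h
    set p := Real.cos ((a - b) / 2) with hp
    have ha : Real.cos (a - (a + b) / 2) = p := by rw [hp]; congr 1; ring
    have hb : Real.cos (b - (a + b) / 2) = p := by
      rw [hp, ← Real.cos_neg]; congr 1; ring
    refine ⟨12 * p ^ 2 - 3, (a + b) / 2, 8 * p ^ 3, ?_, ?_, fun x => ?_⟩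
    · rw [Real.cos_three_mul, ha]; ring
    · rw [Real.cos_three_mul, hb]; ring
    · rw [Real.cos_three_mul]
      set q := Real.cos (x - (a + b) / 2) with hq
      have hq1 : -1 ≤ q := Real.neg_one_le_cos _
      have hpos : 0 < q + 2 * p := by linarith
      have hid : (12 * p ^ 2 - 3) * q - (4 * q ^ 3 - 3 * q)
          = 8 * p ^ 3 - 4 * (q - p) ^ 2 * (q + 2 * p) := by ring
      rw [hid]
      refine ⟨by have : 0 ≤ 4 * (q - p) ^ 2 * (q + 2 * p) := by positivity
                 linarith, fun h0 => ?_⟩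
      have hz : 4 * (q - p) ^ 2 * (q + 2 * p) = 0 := by linarith
      have hqp : p = q := by
        rcases mul_eq_zero.1 hz with hz | hz
        · have : (q - p) ^ 2 = 0 := by linarith
          have := pow_eq_zero_iff (two_ne_zero) |>.1 this
          linarith
        · linarith
      obtain ⟨n, hn | hn⟩ := Real.cos_eq_cos_iff.1 (hp ▸ hq ▸ hqp)
      · exact ⟨n, Or.inl (by linarith)⟩
      · exact ⟨n, Or.inr (by linarith)⟩
  have hsq : Real.cos (a - b) = 2 * Real.cos ((a - b) / 2) ^ 2 - 1 := by
    rw [← Real.cos_two_mul]; congr 1; ring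
  rw [hsq] at h
  by_cases h0 : 1 / 2 < Real.cos ((a - b) / 2)
  · exact main a b h0
  · have h1 : Real.cos ((a - b) / 2) < -(1 / 2) := by
      by_contra h2
      push Not at h0 h2
      nlinarith
    obtain ⟨A, τ, c, hA, hB, hx⟩ := main (a + 2 * Real.pi) b (by
      rw [show (a + 2 * Real.pi - b) / 2 = (a - b) / 2 + Real.pi by ring, Real.cos_add_pi]
      linarith)
    refine ⟨A, τ, c, ?_, hB, fun x => ⟨(hx x).1, fun h => ?_⟩⟩
    · rw [← hA, show a + 2 * Real.pi - τ = (a - τ) + 2 * Real.pi by ring, Real.cos_add_two_pi,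
        show 3 * (a - τ + 2 * Real.pi) = 3 * (a - τ) + (3 : ℕ) * (2 * Real.pi) by push_cast; ring,
        Real.cos_add_nat_mul_two_pi]
    · obtain ⟨n, hn | hn⟩ := (hx x).2 h
      · exact ⟨n + 1, Or.inl (by push_cast; linarith)⟩
      · exact ⟨n, Or.inr hn⟩

/-- The `j`-th of `N` equally spaced points on the curve
`t ↦ (cos t, sin t, cos 3t, sin 3t, cos 9t, sin 9t, …)` in `ℝ^d`. -/
noncomputable def trigPoint (d N : ℕ) (j : ℤ) : Fin d → ℝ := fun i =>
  if Even (i : ℕ) then Real.cos (3 ^ ((i : ℕ) / 2) * (2 * Real.pi * j / N))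
  else Real.sin (3 ^ ((i : ℕ) / 2) * (2 * Real.pi * j / N))

section TrigPoint

variable {d N : ℕ}

lemma trigPoint_emod (hN : 0 < N) (j : ℤ) : trigPoint d N (j % N) = trigPoint d N j := by
  have hN' : (N : ℝ) ≠ 0 := by positivity
  have hj : ((j % N : ℤ) : ℝ) = j - N * (j / N : ℤ) := by
    rw [Int.emod_def]; push_cast; ring
  ext i
  have h : (3 : ℝ) ^ ((i : ℕ) / 2) * (2 * Real.pi * ((j % N : ℤ) : ℝ) / N) =
      3 ^ ((i : ℕ) / 2) * (2 * Real.pi * j / N)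
        - ((3 ^ ((i : ℕ) / 2) * (j / N) : ℤ) : ℝ) * (2 * Real.pi) := by
    rw [hj]; push_cast; field_simp
  simp only [trigPoint, h, Real.cos_sub_int_mul_two_pi, Real.sin_sub_int_mul_two_pi]

lemma trigPoint_add_half {M : ℕ} (hM : 0 < M) (j : ℤ) :
    trigPoint d (2 * M) (j + M) = -trigPoint d (2 * M) j := by
  have hM' : (M : ℝ) ≠ 0 := by positivity
  ext i
  obtain ⟨r, hr⟩ : Odd (3 ^ ((i : ℕ) / 2)) := Odd.pow (by decide)
  have hr' : (3 : ℝ) ^ ((i : ℕ) / 2) = 2 * r + 1 := by exact_mod_cast hr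
  have h : (3 : ℝ) ^ ((i : ℕ) / 2) * (2 * Real.pi * ((j + M : ℤ) : ℝ) / ((2 * M : ℕ) : ℝ)) =
      3 ^ ((i : ℕ) / 2) * (2 * Real.pi * j / ((2 * M : ℕ) : ℝ)) + Real.pi
        + (r : ℕ) * (2 * Real.pi) := by
    rw [hr']; push_cast; field_simp; ring
  simp only [trigPoint, h, Real.cos_add_nat_mul_two_pi, Real.sin_add_nat_mul_two_pi,
    Real.cos_add_pi, Real.sin_add_pi, Pi.neg_apply]
  split_ifs <;> rfl

lemma range_trigPoint (hN : 0 < N) :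
    range (trigPoint d N) = trigPoint d N '' (Finset.Ico (0 : ℤ) N : Finset ℤ) := by
  refine Subset.antisymm ?_ (image_subset_range _ _)
  rintro _ ⟨j, rfl⟩
  refine ⟨j % N, ?_, trigPoint_emod hN j⟩
  simp only [Finset.coe_Ico, mem_Ico]
  exact ⟨Int.emod_nonneg _ (by omega), Int.emod_lt_of_pos _ (by omega)⟩

lemma neg_range_trigPoint {M : ℕ} (hM : 0 < M) :
    -range (trigPoint d (2 * M)) = range (trigPoint d (2 * M)) := by
  have h : ∀ x ∈ range (trigPoint d (2 * M)), -x ∈ range (trigPoint d (2 * M)) := by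
    rintro _ ⟨j, rfl⟩
    exact ⟨j + M, trigPoint_add_half hM j⟩
  ext x
  exact ⟨fun hx => by simpa using h _ hx, fun hx => h x hx⟩

lemma exists_dual_trigPoint_eq_cos {k : ℕ} (hk : 2 * k + 1 < d) (τ : ℝ) :
    ∃ l : StrongDual ℝ (Fin d → ℝ), ∀ j : ℤ,
      l (trigPoint d N j) = Real.cos (3 ^ k * (2 * Real.pi * j / N) - τ) := by
  refine ⟨Real.cos τ • ContinuousLinearMap.proj (R := ℝ) (⟨2 * k, by omega⟩ : Fin d)
    + Real.sin τ • ContinuousLinearMap.proj (R := ℝ) (⟨2 * k + 1, hk⟩ : Fin d), fun j => ?_⟩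
  have h1 : (2 * k + 1) / 2 = k := by omega
  simp [trigPoint, h1, Real.cos_sub]
  ring

lemma dvd_of_angle_eq (hN : 0 < N) (h3 : Nat.Coprime 3 N) {k : ℕ} {i j n : ℤ}
    (h : (3 : ℝ) ^ k * (2 * Real.pi * j / N) = 3 ^ k * (2 * Real.pi * i / N) + n * (2 * Real.pi)) :
    (N : ℤ) ∣ j - i := by
  have hN' : (N : ℝ) ≠ 0 := by positivity
  have hpi := Real.pi_ne_zero
  have h' : (3 : ℝ) ^ k * (j - i) = N * n := by
    field_simp at h
    linarith
  have hz : (3 : ℤ) ^ k * (j - i) = N * n := by exact_mod_cast h'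
  have hcop : IsCoprime (N : ℤ) ((3 : ℤ) ^ k) :=
    (Nat.isCoprime_iff_coprime.2 h3.symm).pow_right
  exact hcop.dvd_of_dvd_mul_left ⟨n, hz⟩

lemma eq_of_dvd_sub_of_mem_Ico {i j : ℤ} (hi : i ∈ Finset.Ico (0 : ℤ) N)
    (hj : j ∈ Finset.Ico (0 : ℤ) N) (h : (N : ℤ) ∣ j - i) : j = i := by
  rw [Finset.mem_Ico] at hi hj
  have := Int.eq_zero_of_abs_lt_dvd h (by rw [abs_lt]; constructor <;> omega)
  omega

lemma exists_dual_trigPoint_lt (hd : 1 < d) (hN : 0 < N) {i : ℤ}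
    (hi : i ∈ Finset.Ico (0 : ℤ) N) :
    ∃ l : StrongDual ℝ (Fin d → ℝ), ∀ j ∈ Finset.Ico (0 : ℤ) N, j ≠ i →
      l (trigPoint d N j) < l (trigPoint d N i) := by
  obtain ⟨l, hl⟩ := exists_dual_trigPoint_eq_cos (d := d) (N := N) (k := 0) (by omega)
    (2 * Real.pi * i / N)
  refine ⟨l, fun j hj hji => ?_⟩
  have hN' : (N : ℝ) ≠ 0 := by positivity
  rw [hl, hl, pow_zero, one_mul, one_mul, sub_self, Real.cos_zero]
  refine lt_of_le_of_ne (Real.cos_le_one _) fun h => hji ?_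
  obtain ⟨n, hn⟩ := (Real.cos_eq_one_iff _).1 h
  refine eq_of_dvd_sub_of_mem_Ico hi hj ⟨n, ?_⟩
  have hpi := Real.pi_ne_zero
  field_simp at hn
  have : (j : ℝ) - i = N * n := by linarith
  exact_mod_cast this

lemma injOn_trigPoint (hd : 1 < d) (hN : 0 < N) :
    InjOn (trigPoint d N) (Finset.Ico (0 : ℤ) N : Finset ℤ) := by
  intro i hi j hj hij
  by_contra hne
  obtain ⟨l, hl⟩ := exists_dual_trigPoint_lt hd hN hi
  exact (hl j hj (Ne.symm hne)).ne (by rw [hij])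

lemma extremePoints_convexHull_range_trigPoint (hd : 1 < d) (hN : 0 < N) :
    (convexHull ℝ (range (trigPoint d N))).extremePoints ℝ = range (trigPoint d N) := by
  refine Subset.antisymm extremePoints_convexHull_subset ?_
  rw [range_trigPoint hN]
  rintro _ ⟨i, hi, rfl⟩
  obtain ⟨l, hl⟩ := exists_dual_trigPoint_lt hd hN hi
  refine mem_extremePoints_convexHull_of_forall_lt ((Finset.finite_toSet _).image _)
    (mem_image_of_mem _ hi) l ?_
  rintro _ ⟨j, hj, rfl⟩ hne
  exact hl j hj fun h => hne (by rw [h])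

lemma ncard_range_trigPoint (hd : 1 < d) (hN : 0 < N) : (range (trigPoint d N)).ncard = N := by
  rw [range_trigPoint hN, (injOn_trigPoint hd hN).ncard_image, ncard_coe_finset]
  simp

lemma exists_dual_trigPoint_edge (hN : 0 < N) (h3 : Nat.Coprime 3 N) {k : ℕ}
    (hk : 2 * k + 3 < d) {i j : ℤ} (hi : i ∈ Finset.Ico (0 : ℤ) N)
    (hj : j ∈ Finset.Ico (0 : ℤ) N)
    (h : -(1 / 2) < Real.cos (3 ^ k * (2 * Real.pi * ((i - j : ℤ) : ℝ) / N))) :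
    ∃ (l : StrongDual ℝ (Fin d → ℝ)) (c : ℝ),
      l (trigPoint d N i) = c ∧ l (trigPoint d N j) = c ∧
      ∀ r ∈ Finset.Ico (0 : ℤ) N, r ≠ i → r ≠ j → l (trigPoint d N r) < c := by
  obtain ⟨A, τ, c, hA, hB, hx⟩ := exists_trig_maximizer
    (a := 3 ^ k * (2 * Real.pi * i / N)) (b := 3 ^ k * (2 * Real.pi * j / N)) (by
      convert h using 2
      push_cast
      ring)
  obtain ⟨l₁, hl₁⟩ := exists_dual_trigPoint_eq_cos (d := d) (N := N) (k := k) (by omega) τ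
  obtain ⟨l₂, hl₂⟩ := exists_dual_trigPoint_eq_cos (d := d) (N := N) (k := k + 1) (by omega)
    (3 * τ)
  have hl : ∀ r : ℤ, (A • l₁ - l₂) (trigPoint d N r) =
      A * Real.cos (3 ^ k * (2 * Real.pi * r / N) - τ)
        - Real.cos (3 * (3 ^ k * (2 * Real.pi * r / N) - τ)) := fun r => by
    simp only [sub_apply, smul_apply, hl₁, hl₂,
      smul_eq_mul]
    congr 2
    ring
  refine ⟨A • l₁ - l₂, c, by rw [hl, hA], by rw [hl, hB], fun r hr hri hrj => ?_⟩
  rw [hl]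
  refine lt_of_le_of_ne (hx _).1 fun heq => ?_
  obtain ⟨n, hn | hn⟩ := (hx _).2 heq
  · exact hri (eq_of_dvd_sub_of_mem_Ico hi hr (dvd_of_angle_eq hN h3 hn))
  · exact hrj (eq_of_dvd_sub_of_mem_Ico hj hr (dvd_of_angle_eq hN h3 hn))

/-- The coordinate functions of the curve are linearly independent on sufficiently many
equally spaced points. -/
lemma eq_zero_of_forall_sum_trigPoint_eq_zero (hN : 2 * 3 ^ ((d - 1) / 2) < N) {c : Fin d → ℝ}
    (hc : ∀ j : ℤ, ∑ i, c i * trigPoint d N j i = 0) : c = 0 := by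
  have hN0 : 0 < N := by omega
  have hN' : (0 : ℝ) < N := by positivity
  have hpi := Real.pi_pos
  set ω : ℕ → ℝ := fun k => 3 ^ k * (2 * Real.pi / N) with hω
  have harg : ∀ (k : ℕ) (j : ℤ), (3 : ℝ) ^ k * (2 * Real.pi * j / N) = j * ω k := fun k j => by
    simp only [hω]; ring
  have hωpos : ∀ k, 0 < ω k := fun k => by positivity
  have hωlt : ∀ i : Fin d, ω ((i : ℕ) / 2) < Real.pi := fun i => by
    have h1 : 3 ^ ((i : ℕ) / 2) ≤ 3 ^ ((d - 1) / 2) :=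
      Nat.pow_le_pow_right (by norm_num) (Nat.div_le_div_right (by omega))
    have h2 : (2 * 3 ^ ((i : ℕ) / 2) : ℝ) < N := by
      exact_mod_cast (Nat.mul_le_mul_left 2 h1).trans_lt hN
    simp only [hω]
    rw [← mul_div_assoc, div_lt_iff₀ hN']
    nlinarith
  have hωinj : ∀ i i' : Fin d, Real.cos (ω ((i : ℕ) / 2)) = Real.cos (ω ((i' : ℕ) / 2)) →
      (i : ℕ) / 2 = (i' : ℕ) / 2 := fun i i' h => by
    have h' := Real.injOn_cos ⟨(hωpos _).le, (hωlt i).le⟩ ⟨(hωpos _).le, (hωlt i').le⟩ h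
    have h'' : (3 : ℝ) ^ ((i : ℕ) / 2) = 3 ^ ((i' : ℕ) / 2) :=
      mul_right_cancel₀ (by positivity) h'
    exact Nat.pow_right_injective (by norm_num : 2 ≤ 3)
      (by exact_mod_cast h'')
  let T : Module.End ℝ (ℤ → ℝ) :=
    LinearMap.funLeft ℝ ℝ (fun j : ℤ => j + 1) + LinearMap.funLeft ℝ ℝ (fun j : ℤ => j - 1)
  have hT : ∀ i : Fin d, (fun j => trigPoint d N j i) ∈
      T.eigenspace (2 * Real.cos (ω ((i : ℕ) / 2))) := fun i => by
    rw [Module.End.mem_eigenspace_iff]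
    ext j
    simp only [T, LinearMap.add_apply, Pi.add_apply, LinearMap.funLeft_apply, Pi.smul_apply,
      smul_eq_mul, trigPoint, harg]
    push_cast
    simp only [add_mul, sub_mul, one_mul, Real.cos_add, Real.cos_sub, Real.sin_add, Real.sin_sub]
    split_ifs <;> ring
  have hblock : ∀ (k : ℝ), ∑ i ∈ Finset.univ.filter fun i : Fin d => 2 * Real.cos (ω ((i : ℕ) / 2)) = k,
      c i • (fun j => trigPoint d N j i) = 0 := by
    have hind := (iSupIndep_iff_finsetSum_eq_zero_imp_eq_zero _).1 T.eigenspaces_iSupIndep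
    intro k
    by_cases hk : k ∈ Finset.univ.image fun i : Fin d => 2 * Real.cos (ω ((i : ℕ) / 2))
    · refine hind (Finset.univ.image fun i : Fin d => 2 * Real.cos (ω ((i : ℕ) / 2)))
        (fun k => ∑ i ∈ Finset.univ.filter fun i : Fin d => 2 * Real.cos (ω ((i : ℕ) / 2)) = k,
          c i • (fun j => trigPoint d N j i))
        (fun k _ => ?_) ?_ k hk
      · refine Submodule.sum_mem _ fun i hi => Submodule.smul_mem _ _ ?_
        rw [← (Finset.mem_filter.1 hi).2]
        exact hT i
      · rw [Finset.sum_fiberwise_of_maps_to fun i hi => Finset.mem_image_of_mem _ hi]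
        ext j
        simpa using hc j
    · refine Finset.sum_eq_zero fun i hi => absurd ?_ hk
      rw [← (Finset.mem_filter.1 hi).2]
      exact Finset.mem_image_of_mem _ (Finset.mem_univ i)
  have heval : ∀ (i : Fin d) (j : ℤ),
      (∀ i' : Fin d, (i' : ℕ) / 2 = (i : ℕ) / 2 → i' ≠ i → c i' * trigPoint d N j i' = 0) →
      c i * trigPoint d N j i = 0 := fun i j h => by
    have h1 := congrFun (hblock (2 * Real.cos (ω ((i : ℕ) / 2)))) j
    rw [Finset.sum_apply, Finset.sum_eq_single i] at h1
    · simpa using h1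
    · intro i' hi' hne
      exact h i' (hωinj _ _ (mul_left_cancel₀ two_ne_zero (Finset.mem_filter.1 hi').2)) hne
    · simp
  have heven : ∀ i : Fin d, Even (i : ℕ) → c i = 0 := fun i hi => by
    have h := heval i 0 fun i' h1 h2 => by
      have : ¬ Even (i' : ℕ) := fun h' => h2 (Fin.ext (by
        obtain ⟨a, ha⟩ := hi; obtain ⟨b, hb⟩ := h'; omega))
      simp [trigPoint, this]
    simpa [trigPoint, hi] using h
  ext i
  by_cases hi : Even (i : ℕ)
  · exact heven i hi
  · have h := heval i 1 fun i' h1 h2 => by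
      have : Even (i' : ℕ) := by
        by_contra h'
        refine h2 (Fin.ext ?_)
        rw [Nat.not_even_iff] at hi h'
        omega
      rw [heven i' this, zero_mul]
    have hs : trigPoint d N 1 i = Real.sin (ω ((i : ℕ) / 2)) := by
      simp [trigPoint, hi, hω]
    rw [hs] at h
    exact (mul_eq_zero.1 h).resolve_right
      (Real.sin_pos_of_pos_of_lt_pi (hωpos _) (hωlt i)).ne'

lemma affineSpan_range_trigPoint {M : ℕ} (hN : 2 * 3 ^ ((d - 1) / 2) < 2 * M) :
    affineSpan ℝ (range (trigPoint d (2 * M))) = ⊤ := by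
  have hM : 0 < M := by omega
  rw [AffineSubspace.affineSpan_eq_top_iff_vectorSpan_eq_top_of_nonempty _ _ _ (range_nonempty _)]
  by_contra hne
  obtain ⟨f, hf, hle⟩ := Submodule.exists_le_ker_of_lt_top _ (lt_top_iff_ne_top.2 hne)
  have hzero : ∀ j : ℤ, f (trigPoint d (2 * M) j) = 0 := fun j => by
    have h := hle (vsub_mem_vectorSpan ℝ (mem_range_self j) (mem_range_self (j + (M : ℤ))))
    rw [LinearMap.mem_ker, trigPoint_add_half hM, vsub_eq_sub, sub_neg_eq_add, map_add] at h
    linarith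
  have hc := eq_zero_of_forall_sum_trigPoint_eq_zero (c := fun i => f (Pi.single i 1)) hN
    fun j => by
      rw [← hzero j, LinearMap.pi_apply_eq_sum_univ f (trigPoint d (2 * M) j)]
      refine Finset.sum_congr rfl fun i _ => ?_
      rw [smul_eq_mul, mul_comm]
      congr 2
      ext i'
      simp [Pi.single_apply, eq_comm]
  refine hf (LinearMap.pi_ext' fun i => LinearMap.ext_ring ?_)
  simpa using congrFun hc i

end TrigPoint

/-- If none of the multiples `3 ^ k * j`, `k < m`, lies in the open arc of two thirds around `0`
modulo `N`, then `j` is close to `N / 2` modulo `N`. -/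
lemma three_pow_mul_abs_le {N : ℕ} (hN : 0 < N) (m : ℕ) (j : ℤ)
    (h : ∀ k < m, Real.cos (3 ^ k * (2 * Real.pi * j / N)) ≤ -(1 / 2)) :
    3 ^ m * |2 * (j % N) - N| ≤ N := by
  have hNz : (0 : ℤ) < N := by exact_mod_cast hN
  have hN' : (0 : ℝ) < N := by positivity
  induction m generalizing j with
  | zero =>
    have h1 := Int.emod_nonneg j hNz.ne'
    have h2 := Int.emod_lt_of_pos j hNz
    rw [pow_zero, one_mul, abs_le]
    constructor <;> omega
  | succ m ih =>
    have hih := ih (3 * j) fun k hk => by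
      have := h (k + 1) (by omega)
      convert this using 2
      push_cast
      ring
    have h0 := h 0 (by omega)
    have h1 := Int.emod_nonneg j hNz.ne'
    have h2 := Int.emod_lt_of_pos j hNz
    have hdm := Int.emod_add_mul_ediv j N
    set r := j % N with hr
    set e := j / N with he
    have hpi := Real.pi_pos
    have hcos : Real.cos (2 * Real.pi * r / N) ≤ -(1 / 2) := by
      convert h0 using 1
      rw [← Real.cos_add_int_mul_two_pi _ e, ← hdm]
      congr 1
      push_cast
      field_simp
    have hthird : Real.cos (2 * Real.pi / 3) = -(1 / 2) := by
      rw [show 2 * Real.pi / 3 = Real.pi - Real.pi / 3 by ring, Real.cos_pi_sub,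
        Real.cos_pi_div_three]
    have hlt : ∀ x : ℝ, 0 ≤ x → x < 2 * Real.pi / 3 → -(1 / 2) < Real.cos x := fun x hx hx' => by
      rw [← hthird]
      exact Real.cos_lt_cos_of_nonneg_of_le_pi hx (by linarith) hx'
    have hr0 : (0 : ℝ) ≤ r := by exact_mod_cast h1
    have hrN : (r : ℝ) < N := by exact_mod_cast h2
    have hlow : (N : ℤ) ≤ 3 * r := by
      by_contra! hcon
      have hcon' : 3 * (r : ℝ) < N := by exact_mod_cast hcon
      refine hcos.not_gt (hlt _ (by positivity) ?_)
      rw [div_lt_div_iff₀ hN' (by norm_num)]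
      nlinarith
    have hhigh : 3 * r ≤ 2 * N := by
      by_contra! hcon
      have hcon' : 2 * (N : ℝ) < 3 * r := by exact_mod_cast hcon
      refine hcos.not_gt ?_
      rw [← Real.cos_two_pi_sub]
      have heq : 2 * Real.pi - 2 * Real.pi * r / N = 2 * Real.pi * (N - r) / N := by
        field_simp
      rw [heq]
      refine hlt _ (div_nonneg (by nlinarith) hN'.le) ?_
      rw [div_lt_div_iff₀ hN' (by norm_num)]
      nlinarith
    have hmod : |2 * (3 * j % N) - N| = 3 * |2 * r - N| := by
      have h3j : 3 * j % N = (3 * r) % N := by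
        rw [← hdm, show 3 * (r + N * e) = 3 * r + N * (3 * e) by ring, Int.add_mul_emod_self_left]
      rw [h3j, show (3 : ℤ) * |2 * r - N| = |3 * (2 * r - N)| by rw [abs_mul]; rfl]
      rcases hhigh.lt_or_eq with hlt' | heq
      · rw [show 3 * r = (3 * r - N) + N * 1 by ring, Int.add_mul_emod_self_left,
          Int.emod_eq_of_lt (by omega) (by omega)]
        congr 1
        ring
      · rw [heq, show (2 : ℤ) * N = N * 2 by ring, Int.mul_emod_right,
          show 3 * (2 * r - N) = (N : ℤ) by omega]
        simp
    rw [hmod] at hih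
    calc (3 : ℤ) ^ (m + 1) * |2 * r - N| = 3 ^ m * (3 * |2 * r - N|) := by ring
      _ ≤ N := hih

open Classical in
/-- All but `2 * q - 1` of the points are at an angle to `i` which, after multiplication by some
`3 ^ k` with `k < m`, is less than `2π/3`. -/
lemma card_filter_cos_le {m q M : ℕ} (hm : M + 1 = 3 ^ m * q) (hM : 0 < M) (i : ℤ) :
    {j ∈ Finset.Ico (0 : ℤ) (2 * M : ℕ) | ∀ k < m,
      Real.cos (3 ^ k * (2 * Real.pi * ((i - j : ℤ) : ℝ) / (2 * M : ℕ))) ≤ -(1 / 2)}.card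
      ≤ 2 * q - 1 := by
  have hq : 0 < q := Nat.pos_of_ne_zero (by rintro rfl; omega)
  have hcard : (Finset.Icc ((M : ℤ) - q + 1) (M + q - 1)).card = 2 * q - 1 := by
    rw [Int.card_Icc]; omega
  rw [← hcard]
  refine Finset.card_le_card_of_injOn (fun j => (i - j) % (2 * M : ℕ)) ?_ ?_
  · intro j hj
    have hj := (Finset.mem_filter.1 hj).2
    have h := three_pow_mul_abs_le (N := 2 * M) (by omega) m (i - j) hj
    simp only [Finset.coe_Icc, mem_Icc]
    set r := (i - j) % ((2 * M : ℕ) : ℤ)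
    have habs : |2 * r - ((2 * M : ℕ) : ℤ)| = 2 * |r - M| := by
      rw [show 2 * r - ((2 * M : ℕ) : ℤ) = 2 * (r - M) by push_cast; ring, abs_mul]
      rfl
    rw [habs] at h
    have hm' : (M : ℤ) + 1 = 3 ^ m * q := by exact_mod_cast hm
    have hlt : (3 : ℤ) ^ m * |r - M| < 3 ^ m * q := by push_cast at h; linarith
    have := abs_lt.1 (lt_of_mul_lt_mul_left hlt (by positivity))
    omega
  · intro j hj j' hj' h
    have hj := (Finset.mem_filter.1 hj).1
    have hj' := (Finset.mem_filter.1 hj').1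
    refine eq_of_dvd_sub_of_mem_Ico hj' hj ?_
    simpa using Int.ModEq.dvd h

theorem stmt3 {d : ℕ} (hd : 4 ≤ d) (N₀ : ℕ) :
    ∃ N : ℕ, N₀ ≤ N ∧
      ∃ P : Set (Fin d → ℝ),
        IsPolytope P ∧ P = -P ∧ affineSpan ℝ P = ⊤ ∧
        (P.extremePoints ℝ).ncard = N ∧
        (1 - (3 : ℝ) ^ (-((d / 2 - 1 : ℕ) : ℤ))) * (N.choose 2) ≤ (faceCount P 1 : ℝ) := by
  classical
  set m := d / 2 - 1 with hm
  have hm1 : 1 ≤ m := by omega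
  have h3m : 3 ≤ 3 ^ m := by simpa using Nat.pow_le_pow_right (n := 3) (by norm_num) hm1
  set q := N₀ + 4 with hq
  obtain ⟨M, hM⟩ : ∃ M, M + 1 = 3 ^ m * q :=
    ⟨3 ^ m * q - 1, Nat.sub_add_cancel (Nat.mul_pos (by positivity) (by omega))⟩
  have hexp : 3 ^ ((d - 1) / 2) ≤ 3 ^ m * 3 := by
    rw [← pow_succ]
    exact Nat.pow_le_pow_right (by norm_num) (by omega)
  have hMq : 3 ^ m * 3 < M ∧ N₀ ≤ M := by
    have h1 : 3 ^ m * q = 3 ^ m * N₀ + 3 ^ m * 4 := by rw [hq]; ring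
    have h2 := Nat.mul_le_mul_right N₀ h3m
    constructor <;> omega
  have hM0 : 0 < M := by omega
  have hN0 : 0 < 2 * M := by omega
  have hcop : Nat.Coprime 3 (2 * M) := by
    rw [Nat.Prime.coprime_iff_not_dvd Nat.prime_three]
    have h3 : 3 ∣ M + 1 := hM ▸ (dvd_pow_self 3 (by omega)).mul_right q
    omega
  have hV := range_trigPoint (d := d) hN0
  have htop : affineSpan ℝ (convexHull ℝ (range (trigPoint d (2 * M)))) = ⊤ := by
    rw [affineSpan_convexHull]
    exact affineSpan_range_trigPoint (by omega)
  refine ⟨2 * M, by omega, convexHull ℝ (range (trigPoint d (2 * M))), ?_, ?_, htop, ?_, ?_⟩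
  · exact ⟨(Finset.Ico (0 : ℤ) (2 * M : ℕ)).image (trigPoint d (2 * M)), by
      rw [Finset.coe_image, hV]⟩
  · rw [← convexHull_neg, neg_range_trigPoint hM0]
  · rw [extremePoints_convexHull_range_trigPoint (by omega) hN0,
      ncard_range_trigPoint (by omega) hN0]
  set s := Finset.Ico (0 : ℤ) (2 * M : ℕ) with hs
  have hscard : s.card = 2 * M := by rw [hs, Int.card_Ico]; omega
  set good : ℤ × ℤ → Prop := fun p => p.1 ≠ p.2 ∧ ∃ k < m,
    -(1 / 2) < Real.cos (3 ^ k * (2 * Real.pi * ((p.1 - p.2 : ℤ) : ℝ) / (2 * M : ℕ))) with hgood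
  have hfaces : ((s ×ˢ s).filter good).card ≤
      2 * faceCount (convexHull ℝ (range (trigPoint d (2 * M)))) 1 := by
    rw [hV] at htop ⊢
    refine card_le_two_mul_faceCount (by omega) (injOn_trigPoint (by omega) hN0) htop
      fun p hp => ?_
    obtain ⟨hp, hne, k, hk, hcos⟩ := Finset.mem_filter.1 hp
    obtain ⟨h1, h2⟩ := Finset.mem_product.1 hp
    exact ⟨h1, h2, hne, exists_dual_trigPoint_edge hN0 hcop (by omega) h1 h2 hcos⟩
  have hrow : ∀ i ∈ s, 2 * M - 2 * q ≤ (s.filter fun j => good (i, j)).card := fun i hi => by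
    have hbad := card_filter_cos_le hM hM0 i
    set bad := {j ∈ Finset.Ico (0 : ℤ) (2 * M : ℕ) | ∀ k < m,
      Real.cos (3 ^ k * (2 * Real.pi * ((i - j : ℤ) : ℝ) / (2 * M : ℕ))) ≤ -(1 / 2)}
    have hcover : s ⊆ insert i ((s.filter fun j => good (i, j)) ∪ bad) := fun j hj => by
      by_cases hij : i = j
      · simp [hij]
      · refine Finset.mem_insert_of_mem (Finset.mem_union.2 ?_)
        by_cases hg : good (i, j)
        · exact Or.inl (Finset.mem_filter.2 ⟨hj, hg⟩)
        · refine Or.inr (Finset.mem_filter.2 ⟨hj, fun k hk => ?_⟩)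
          by_contra! hcos
          exact hg ⟨hij, k, hk, hcos⟩
    have h1 := Finset.card_le_card hcover
    have h2 := Finset.card_insert_le i ((s.filter fun j => good (i, j)) ∪ bad)
    have h3 := Finset.card_union_le (s.filter fun j => good (i, j)) bad
    omega
  have hcount : 2 * M * (2 * M - 2 * q) ≤ ((s ×ˢ s).filter good).card := by
    rw [Finset.card_filter, Finset.sum_product, ← hscard, ← smul_eq_mul, hscard]
    nth_rw 1 [← hscard]
    refine Finset.card_nsmul_le_sum _ _ _ fun i hi => ?_
    rw [← Finset.card_filter]
    exact hrow i hi
  have hqM : 2 * q ≤ 2 * M := by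
    have := Nat.mul_le_mul_right q h3m
    omega
  have htotal : (2 * M : ℝ) * (2 * M - 2 * q) ≤
      2 * faceCount (convexHull ℝ (range (trigPoint d (2 * M)))) 1 := by
    have := hcount.trans hfaces
    rw [← Nat.cast_le (α := ℝ)] at this
    push_cast [Nat.cast_sub hqM] at this
    exact this
  have hT3 : (3 : ℝ) ≤ 3 ^ m := by exact_mod_cast h3m
  have hMr : (M : ℝ) + 1 = 3 ^ m * q := by exact_mod_cast hM
  rw [zpow_neg, zpow_natCast, Nat.cast_choose_two]
  push_cast
  set T : ℝ := 3 ^ m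
  have hT0 : 0 < T := by linarith
  have hratio : (1 - T⁻¹) * (2 * M - 1) ≤ 2 * M - 2 * q := by
    have hid : 2 * (M : ℝ) - 2 * q - (1 - T⁻¹) * (2 * M - 1) = T⁻¹ * (T - 3) := by
      have hM' : (M : ℝ) = T * q - 1 := by linarith
      rw [hM']
      field_simp
      ring
    have : 0 ≤ T⁻¹ * (T - 3) := mul_nonneg (by positivity) (by linarith)
    linarith
  have := mul_le_mul_of_nonneg_left hratio (by positivity : (0 : ℝ) ≤ M)
  linarith
end

section
/- Let P ⊂ ℝ^d be a centrally symmetric d-polytope with at least 2(d+2) vertices. Then P is not (⌊(d+1)/3⌋ + 1)-neighborly: there exists a set of ⌊(d+1)/3⌋ + 1 vertices of P, no two of which are antipodal, that is not the vertex set of any face of P. -/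
open Set

/-- The indices of a finite real family split into `k` small ones, `k` large ones, and the rest,
with values separated by two thresholds `p ≤ q`. -/
lemma exists_threshold_split {n k : ℕ} (hk : 0 < k) (h2k : 2 * k ≤ n) (t : Fin n → ℝ) :
    ∃ (p q : ℝ) (A C : Finset (Fin n)), p ≤ q ∧ A.card = k ∧ C.card = k ∧ Disjoint A C ∧
      (∀ i ∈ A, t i ≤ p) ∧ (∀ i ∈ C, q ≤ t i) ∧ (∀ i ∉ A, p ≤ t i) ∧ (∀ i ∉ C, t i ≤ q) := by
  classical
  set π := Tuple.sort t with hπ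
  have hm : Monotone (t ∘ π) := Tuple.monotone_sort t
  have key : ∀ {i j : Fin n}, π.symm i ≤ π.symm j → t i ≤ t j := by
    intro i j h
    simpa using hm h
  have hlow : k < n := by omega
  have hhigh : n - k < n := by omega
  refine ⟨t (π ⟨k, hlow⟩), t (π ⟨n - k, hhigh⟩),
    (Finset.univ.filter fun j : Fin n => j.val < k).map π.toEmbedding,
    (Finset.univ.filter fun j : Fin n => n - k ≤ j.val).map π.toEmbedding, ?_, ?_, ?_, ?_, ?_, ?_,
    ?_, ?_⟩
  · apply hm
    rw [Fin.mk_le_mk]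
    omega
  · rw [Finset.card_map, Fin.card_filter_val_lt]
    omega
  · rw [Finset.card_map]
    have h1 := Finset.card_filter_add_card_filter_not (s := (Finset.univ : Finset (Fin n)))
      (fun j : Fin n => j.val < n - k)
    rw [Fin.card_filter_val_lt] at h1
    simp only [not_lt, Finset.card_univ, Fintype.card_fin] at h1
    omega
  · rw [Finset.disjoint_map, Finset.disjoint_filter]
    intro j _ h1 h2
    omega
  all_goals
    intro i hi
    simp only [Finset.mem_map_equiv, Finset.mem_filter, Finset.mem_univ, true_and, not_lt,
      not_le] at hi
    apply key
    simp only [Equiv.symm_apply_apply, Fin.le_def]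
    omega

/-- Every plane in `ℝⁿ` contains a nonzero vector some `k` of whose coordinates carry at least
half of its `ℓ¹` norm, provided `n ≤ 3 * k`. -/
lemma exists_half_l1_norm_on_small_support {n k : ℕ} (hk : 0 < k) (h2k : 2 * k ≤ n)
    (h3k : n ≤ 3 * k) (a b : Fin n → ℝ) (hab : LinearIndependent ℝ ![a, b]) :
    ∃ c ∈ Submodule.span ℝ {a, b}, c ≠ 0 ∧ ∃ I : Finset (Fin n), I.card ≤ k ∧
      0 ≤ ∑ i, if i ∈ I then |c i| else -|c i| := by
  classical
  rw [LinearIndependent.pair_iff] at hab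
  obtain ⟨s, hs⟩ := Infinite.exists_notMem_finset
    (Finset.univ.image fun i => -b i / a i)
  set e : Fin n → ℝ := b + s • a with he
  have hea : ∀ i, e i = 0 → a i = 0 := by
    intro i hi
    by_contra hai
    apply hs
    simp only [Finset.mem_image, Finset.mem_univ, true_and]
    refine ⟨i, ?_⟩
    simp only [he, Pi.add_apply, Pi.smul_apply, smul_eq_mul] at hi
    field_simp
    linarith
  have hmem : ∀ x y : ℝ, x • a + y • e ∈ Submodule.span ℝ {a, b} := fun x y =>
    Submodule.mem_span_pair.2 ⟨x + y * s, y, by rw [he]; module⟩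
  have hne : ∀ x y : ℝ, x • a + y • e = 0 → x = 0 ∧ y = 0 := by
    intro x y h
    have := hab (x + y * s) y (by rw [← h, he]; module)
    obtain ⟨h1, rfl⟩ := this
    exact ⟨by simpa using h1, rfl⟩
  obtain ⟨p, q, A, C, hpq, hA, hC, hAC, hAp, hCq, hAp', hCq'⟩ :=
    exists_threshold_split hk h2k fun i => -a i / e i
  by_contra! hcon
  have hval : ∀ (x : ℝ) i, ((1 : ℝ) • a + x • e) i = e i * (x - -a i / e i) := by
    intro x i
    by_cases h : e i = 0
    · simp [h, hea i h]
    · simp only [Pi.add_apply, Pi.smul_apply, smul_eq_mul, one_smul]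
      field_simp
      ring
  have hB : (A ∪ C)ᶜ.card ≤ k := by
    rw [Finset.card_compl, Finset.card_union_of_disjoint hAC, Fintype.card_fin]
    omega
  have h1 := hcon ((1 : ℝ) • a + q • e) (hmem 1 q)
    (fun h => one_ne_zero (hne _ _ h).1) A hA.le
  have h2 := hcon ((1 : ℝ) • a + p • e) (hmem 1 p)
    (fun h => one_ne_zero (hne _ _ h).1) C hC.le
  have h3 := hcon ((0 : ℝ) • a + (1 : ℝ) • e) (hmem 0 1)
    (fun h => one_ne_zero (hne _ _ h).2) _ hB
  have h3' := mul_nonpos_of_nonneg_of_nonpos (sub_nonneg.2 hpq) h3.le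
  rw [Finset.mul_sum] at h3'
  have hsum := add_neg_of_neg_of_nonpos (add_neg h1 h2) h3'
  rw [← Finset.sum_add_distrib, ← Finset.sum_add_distrib] at hsum
  refine absurd hsum (not_lt.2 (Finset.sum_nonneg fun i _ => ?_))
  rw [hval, hval]
  simp only [zero_smul, zero_add, one_smul, Finset.mem_compl, Finset.mem_union, abs_mul]
  have hei := abs_nonneg (e i)
  by_cases hiA : i ∈ A
  · have hiC : i ∉ C := Finset.disjoint_left.1 hAC hiA
    have hp := hAp i hiA
    simp only [hiA, hiC, if_true, if_false, true_or, not_true_eq_false]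
    rw [abs_of_nonneg (by linarith : 0 ≤ q - -a i / e i),
      abs_of_nonneg (by linarith : 0 ≤ p - -a i / e i)]
    nlinarith
  · have hp := hAp' i hiA
    by_cases hiC : i ∈ C
    · have hq := hCq i hiC
      simp only [hiA, hiC, if_true, if_false, or_true, not_true_eq_false]
      rw [abs_of_nonpos (by linarith : q - -a i / e i ≤ 0),
        abs_of_nonpos (by linarith : p - -a i / e i ≤ 0)]
      nlinarith
    · have hq := hCq' i hiC
      simp only [hiA, hiC, if_true, if_false, or_self, not_false_eq_true]
      rw [abs_of_nonneg (by linarith : 0 ≤ q - -a i / e i),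
        abs_of_nonpos (by linarith : p - -a i / e i ≤ 0)]
      nlinarith

/-- A finite symmetric set with at least `2 * n` elements, not containing the fixed point `0`,
contains `n` elements that are pairwise neither equal nor antipodal. -/
lemma exists_pairwise_nonantipodal {G : Type*} [AddCommGroup G] {E : Set G} (hfin : E.Finite)
    (hsym : ∀ x ∈ E, -x ∈ E) (hself : ∀ x ∈ E, -x ≠ x) {n : ℕ} (hn : 2 * n ≤ E.ncard) :
    ∃ v : Fin n → G, (∀ i, v i ∈ E) ∧ Function.Injective v ∧ ∀ i j, v i ≠ -v j := by
  classical
  lift E to Finset G using hfin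
  rw [Set.ncard_coe_finset] at hn
  simp only [Finset.mem_coe] at hsym hself ⊢
  obtain ⟨T, hT, hmax⟩ := Finset.exists_max_image
    (E.powerset.filter fun T => ∀ x ∈ T, -x ∉ T) Finset.card ⟨∅, by simp⟩
  simp only [Finset.mem_filter, Finset.mem_powerset] at hT hmax
  have hcover : E ⊆ T ∪ T.image Neg.neg := by
    intro x hx
    by_contra hxT
    simp only [Finset.mem_union, Finset.mem_image, not_or, not_exists, not_and] at hxT
    have hxn : -x ∉ T := fun h => hxT.2 _ h (neg_neg x)
    have := hmax (insert x T) ⟨Finset.insert_subset hx hT.1, by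
      intro y hy hy'
      rw [Finset.mem_insert] at hy hy'
      rcases hy with rfl | hy
      · exact hy'.elim (hself y hx) hxn
      · rcases hy' with h | h
        · exact hxT.2 _ hy h
        · exact hT.2 y hy h⟩
    rw [Finset.card_insert_of_notMem hxT.1] at this
    omega
  have hcard := (Finset.card_le_card hcover).trans (Finset.card_union_le _ _)
  have himg : (T.image Neg.neg).card ≤ T.card := Finset.card_image_le
  obtain ⟨U, hUT, hU⟩ := Finset.exists_subset_card_eq (show n ≤ T.card by omega)
  let f := U.equivFinOfCardEq hU
  refine ⟨fun i => (f.symm i : G), fun i => hT.1 (hUT (f.symm i).2),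
    Subtype.val_injective.comp f.symm.injective, fun i j h => ?_⟩
  apply hT.2 _ (hUT (f.symm j).2)
  rw [← h]
  exact hUT (f.symm i).2

/-- If `σ i • v i` (`i ∈ I`) are exactly the vertices of a proper face of the centrally symmetric
set `P`, then some functional equals `1` at these points and has absolute value less than `1`
at all other `v j`. -/
lemma exists_supporting_functional {E ι : Type*} [AddCommGroup E] [Module ℝ E]
    [TopologicalSpace E] {P F : Set E} (hsym : P = -P)
    {v : ι → E} (hv : ∀ i, v i ∈ P.extremePoints ℝ) (hneg : ∀ i, -v i ∈ P.extremePoints ℝ)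
    {S : Set E} (hF : IsProperFace P F) (hFS : F.extremePoints ℝ = S) :
    ∃ l : E →ₗ[ℝ] ℝ, (∀ x ∈ S, l x = 1) ∧ (∀ i, v i ∉ S → -v i ∉ S → |l (v i)| < 1) := by
  obtain ⟨hne, hFP, hexp⟩ := hF
  obtain ⟨l, hl⟩ := hexp hne
  obtain ⟨x₀, hx₀⟩ := hne
  have hx₀' := hl ▸ hx₀
  have hmem : ∀ x, x ∈ F ↔ x ∈ P ∧ l x = l x₀ := by
    intro x
    rw [hl]
    refine ⟨fun h => ⟨h.1, le_antisymm (hx₀'.2 x h.1) (h.2 x₀ hx₀'.1)⟩, fun h => ⟨h.1, ?_⟩⟩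
    intro y hy
    exact (hx₀'.2 y hy).trans h.2.ge
  have hnegP : ∀ x ∈ P, -x ∈ P := by
    intro x hx
    rw [hsym] at hx
    exact hx
  have hle : ∀ x ∈ P, |l x| ≤ l x₀ := by
    intro x hx
    rw [abs_le']
    exact ⟨hx₀'.2 x hx, by simpa using hx₀'.2 _ (hnegP x hx)⟩
  have hpos : 0 < l x₀ := by
    refine lt_of_le_of_ne ((abs_nonneg _).trans (hle x₀ hx₀'.1)) fun h0 => hFP ?_
    ext x
    rw [hmem]
    refine ⟨fun h => h.1, fun h => ⟨h, ?_⟩⟩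
    have := hle x h
    rw [← h0] at this ⊢
    exact abs_nonpos_iff.1 this
  have hsub : F ⊆ P := fun x hx => ((hmem x).1 hx).1
  have hext : ∀ x ∈ P.extremePoints ℝ, l x = l x₀ → x ∈ S := by
    intro x hx h
    rw [← hFS]
    exact inter_extremePoints_subset_extremePoints_of_subset hsub ⟨(hmem x).2 ⟨hx.1, h⟩, hx⟩
  refine ⟨(l x₀)⁻¹ • (l : E →ₗ[ℝ] ℝ), ?_, ?_⟩
  · intro x hx
    rw [← hFS] at hx
    simp only [LinearMap.smul_apply, ContinuousLinearMap.coe_coe, smul_eq_mul]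
    rw [((hmem x).1 hx.1).2]
    exact inv_mul_cancel₀ hpos.ne'
  · intro i h1 h2
    have hlt : |l (v i)| < l x₀ := by
      refine lt_of_le_of_ne (hle _ (hv i).1) fun h => ?_
      rcases abs_choice (l (v i)) with h' | h'
      · exact h1 (hext _ (hv i) (h' ▸ h))
      · exact h2 (hext _ (hneg i) (by rw [map_neg, ← h', h]))
    simp only [LinearMap.smul_apply, ContinuousLinearMap.coe_coe, smul_eq_mul, abs_mul]
    rw [abs_of_pos (inv_pos.2 hpos), inv_mul_lt_iff₀ hpos, mul_one]
    exact hlt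

/-- In a nontrivial linear dependence, the coefficients at which a functional attains the value
`± 1` matching their sign have absolute sum less than the others, if the functional is less
than `1` in absolute value at the other vectors. -/
lemma sum_abs_neg_of_dependence {E ι : Type*} [AddCommGroup E] [Module ℝ E] [Fintype ι]
    [DecidableEq ι] {v : ι → E} {c : ι → ℝ} (hc : c ≠ 0) (hcv : ∑ i, c i • v i = 0)
    {I : Finset ι} {l : E →ₗ[ℝ] ℝ} (hI : ∀ i ∈ I, c i * l (v i) = |c i|)
    (hI' : ∀ i ∉ I, |l (v i)| < 1) :
    ∑ i, (if i ∈ I then |c i| else -|c i|) < 0 := by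
  have h0 : ∑ i, c i * l (v i) = 0 := by
    have := congrArg l hcv
    simpa using this
  have hle : ∀ i, (if i ∈ I then |c i| else -|c i|) ≤ c i * l (v i) := by
    intro i
    split_ifs with h
    · exact (hI i h).ge
    · have h1 := neg_abs_le (c i * l (v i))
      rw [abs_mul] at h1
      nlinarith [abs_nonneg (c i), hI' i h]
  rw [← h0]
  refine Finset.sum_lt_sum (fun i _ => hle i) ?_
  by_contra! hcon
  have hoff : ∀ i ∉ I, c i = 0 := by
    intro i hi
    by_contra hci
    have h1 := hcon i (Finset.mem_univ i)
    rw [if_neg hi] at h1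
    have h2 := neg_abs_le (c i * l (v i))
    rw [abs_mul] at h2
    nlinarith [abs_pos.2 hci, hI' i hi]
  have hterm : ∀ i, c i * l (v i) = |c i| := by
    intro i
    by_cases hi : i ∈ I
    · exact hI i hi
    · simp [hoff i hi]
  simp only [hterm] at h0
  apply hc
  ext i
  have := (Finset.sum_eq_zero_iff_of_nonneg fun i _ => abs_nonneg (c i)).1 h0 i
    (Finset.mem_univ i)
  simpa using this

/-- `d + 2` vectors in `ℝᵈ` admit two linearly independent linear dependences. -/
lemma exists_two_dependences {d : ℕ} (v : Fin (d + 2) → Fin d → ℝ) :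
    ∃ a b : Fin (d + 2) → ℝ, LinearIndependent ℝ ![a, b] ∧
      ∀ c ∈ Submodule.span ℝ {a, b}, ∑ i, c i • v i = 0 := by
  set K := LinearMap.ker (Fintype.linearCombination ℝ v) with hK
  have hrank : 2 ≤ Module.finrank ℝ K := by
    have h1 := LinearMap.finrank_range_add_finrank_ker (Fintype.linearCombination ℝ v)
    have h2 := Submodule.finrank_le (LinearMap.range (Fintype.linearCombination ℝ v))
    rw [← hK] at h1
    simp only [Module.finrank_fin_fun] at h1 h2
    omega
  obtain ⟨f, hf⟩ := exists_linearIndependent_of_le_finrank hrank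
  refine ⟨f 0, f 1, ?_, fun c hc => ?_⟩
  · have := hf.map' K.subtype K.ker_subtype
    rwa [show ![(f 0 : Fin (d + 2) → ℝ), (f 1 : Fin (d + 2) → ℝ)] = K.subtype ∘ f by
      ext i j
      fin_cases i <;> rfl]
  · have hle : Submodule.span ℝ {(f 0 : Fin (d + 2) → ℝ), (f 1 : Fin (d + 2) → ℝ)} ≤ K := by
      rw [Submodule.span_le]
      rintro x (rfl | rfl)
      · exact (f 0).2
      · exact (f 1).2
    simpa [hK, Fintype.linearCombination_apply] using hle hc

theorem stmt10 {d : ℕ} (P : Set (Fin d → ℝ))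
    (hpoly : IsPolytope P) (hsym : P = -P) (hfull : affineSpan ℝ P = ⊤)
    (hN : 2 * (d + 2) ≤ (P.extremePoints ℝ).ncard) :
    ∃ S : Set (Fin d → ℝ), S ⊆ P.extremePoints ℝ ∧
      S.ncard = (d + 1) / 3 + 1 ∧ (∀ v ∈ S, -v ∉ S) ∧
      ¬ ∃ F : Set (Fin d → ℝ), IsProperFace P F ∧ F.extremePoints ℝ = S := by
  classical
  have hfin : (P.extremePoints ℝ).Finite := by
    obtain ⟨V, rfl⟩ := hpoly
    exact V.finite_toSet.subset extremePoints_convexHull_subset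
  have hnegP : ∀ x ∈ P, -x ∈ P := by
    intro x hx
    rw [hsym] at hx
    exact hx
  have hnegE : ∀ x ∈ P.extremePoints ℝ, -x ∈ P.extremePoints ℝ := by
    intro x hx
    refine ⟨hnegP x hx.1, fun y hy z hz hxyz => ?_⟩
    have h1 : x ∈ openSegment ℝ (-y) (-z) := by
      obtain ⟨α, β, hα, hβ, hαβ, h⟩ := hxyz
      exact ⟨α, β, hα, hβ, hαβ, by rw [← neg_neg x, ← h]; module⟩
    rw [← hx.2 (hnegP y hy) (hnegP z hz) h1, neg_neg]
  have hself : ∀ x ∈ P.extremePoints ℝ, -x ≠ x := by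
    intro x hx hxx
    have hx0 : x = 0 := self_eq_neg.1 hxx.symm
    subst hx0
    have hP : ∀ y ∈ P, y = 0 := fun y hy =>
      hx.2 hy (hnegP y hy) ⟨1 / 2, 1 / 2, by norm_num, by norm_num, by norm_num, by module⟩
    have : (P.extremePoints ℝ).ncard ≤ 1 := by
      rw [Set.ncard_le_one hfin]
      intro y hy z hz
      rw [hP y hy.1, hP z hz.1]
    omega
  obtain ⟨v, hvE, hvinj, hvneg⟩ := exists_pairwise_nonantipodal hfin hnegE hself hN
  obtain ⟨a, b, hab, hdep⟩ := exists_two_dependences v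
  obtain ⟨c, hcmem, hc, I₀, hI₀, hsum⟩ := exists_half_l1_norm_on_small_support
    (k := (d + 1) / 3 + 1) (by omega) (by omega) (by omega) a b hab
  obtain ⟨I, hI₀I, hI⟩ := Finset.exists_superset_card_eq hI₀
    (by rw [Fintype.card_fin]; omega)
  let w : Fin (d + 2) → Fin d → ℝ := fun i => if 0 ≤ c i then v i else -v i
  have hw : ∀ i, w i = v i ∨ w i = -v i := fun i => ite_eq_or_eq _ _ _
  have hwv : ∀ i j, (w i = v j ∨ w i = -v j) → i = j := by
    intro i j h
    rcases hw i with hi | hi <;> rw [hi] at h <;> rcases h with h | h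
    · exact hvinj h
    · exact absurd h (hvneg i j)
    · exact absurd h.symm (hvneg j i)
    · exact hvinj (neg_injective h)
  have hwinj : Function.Injective w := fun i j h => hwv i j (h ▸ hw j)
  refine ⟨w '' I, ?_, ?_, ?_, ?_⟩
  · rintro _ ⟨i, -, rfl⟩
    rcases hw i with h | h <;> rw [h]
    · exact hvE i
    · exact hnegE _ (hvE i)
  · rw [Set.ncard_image_of_injective _ hwinj, Set.ncard_coe_finset, hI]
  · rintro _ ⟨i, -, rfl⟩ ⟨j, -, hj⟩
    have hji : j = i := hwv j i (by
      rcases hw i with h | h <;> rw [hj, h] <;> simp)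
    subst hji
    rcases hw j with h | h <;> rw [h] at hj
    · exact hself _ (hvE j) hj.symm
    · exact hself _ (hnegE _ (hvE j)) hj.symm
  · rintro ⟨F, hF, hFS⟩
    obtain ⟨l, hl1, hl2⟩ :=
      exists_supporting_functional hsym hvE (fun i => hnegE _ (hvE i)) hF hFS
    have hneg := sum_abs_neg_of_dependence hc (hdep c hcmem) (I := I) (l := l) (by
      intro i hi
      have h1 := hl1 (w i) ⟨i, hi, rfl⟩
      by_cases hci : 0 ≤ c i
      · simp only [w, if_pos hci] at h1
        rw [h1, abs_of_nonneg hci, mul_one]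
      · simp only [w, if_neg hci, map_neg] at h1
        rw [abs_of_neg (not_le.1 hci)]
        linear_combination (-c i) * h1) (by
      intro i hi
      apply hl2 i
      · rintro ⟨j, hj, hji⟩
        exact hi (hwv j i (Or.inl hji) ▸ hj)
      · rintro ⟨j, hj, hji⟩
        exact hi (hwv j i (Or.inr hji) ▸ hj))
    refine absurd (hsum.trans (Finset.sum_le_sum fun i _ => ?_)) (not_le.2 hneg)
    have := abs_nonneg (c i)
    split_ifs with h1 h2 h2
    · exact le_rfl
    · exact absurd (hI₀I h1) h2
    · linarith
    · exact le_rfl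
end
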